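/- If principal 1's algorithm ALG_1 is BayesGreedy and principal 2's algorithm ALG_2 deviates from BayesGreedy starting from some local step n_0 < T, then the Bayesian-expected rewards of the two algorithms, run in isolation, satisfy E[rew_1(n_0)] > E[rew_2(n_0)]. This holds for any response function f_resp, since it only concerns the stand-alone performance of each algorithm. -/

import Mathlib

/-
A formalization of the Bayesian-choice model of competing bandits.

Two principals each commit to a multi-armed bandit algorithm over a finite set
`A` of arms with Bernoulli rewards.  The mean-reward vector `w : A → ℝ` is drawn
once from a common Bayesian prior `P`.  An algorithm is a map from (reversed)
histories of (arm, reward) pairs to distributions over arms.  Agents arrive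
sequentially; agent `t` (rounds are 1-indexed) chooses principal 1 with
probability `fresp (PMR₁(t) - PMR₂(t))`, where `PMRᵢ(t)` is the Bayesian
posterior mean reward of principal `i`'s next local step; the chosen principal's
algorithm advances one local step.
-/

open MeasureTheory
open scoped Classical

namespace BayesianChoice

/-- A history: a list of (arm, Bernoulli reward) pairs, most recent step first. -/
abbrev History (A : Type) := List (A × Bool)

/-- An MAB algorithm: a distribution over arms, given the observed history.
(Note that such algorithms never depend on the time horizon `T`:
they are automatically `T`-oblivious.) -/
abbrev Alg (A : Type) := History A → PMF A

variable {A : Type} [Fintype A] [Nonempty A]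

/-- Likelihood of the reward sequence in history `h`, given mean-reward vector `w`
(rewards are Bernoulli, independent across steps given `w`). -/
noncomputable def lik (w : A → ℝ) : History A → ℝ
  | [] => 1
  | (a, r) :: h => lik w h * (if r then w a else 1 - w a)

/-- Probability that a stand-alone run of `alg` produces history `h`, given `w`. -/
noncomputable def hProb (alg : Alg A) (w : A → ℝ) : History A → ℝ
  | [] => 1
  | (a, r) :: h => hProb alg w h * ((alg h) a).toReal * (if r then w a else 1 - w a)

variable (P : Measure (A → ℝ))

/-- The prior `P` is supported on mean rewards in `[0,1]` (Bernoulli parameters). -/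
def PriorOnUnitCube : Prop := P {w | ∀ a : A, w a ∈ Set.Icc (0:ℝ) 1} = 1

/-- A history is feasible if it has positive marginal likelihood under the prior. -/
def Feasible (h : History A) : Prop := 0 < ∫ w, lik w h ∂P

/-- Posterior mean reward `E[μ_a | h]` of arm `a` given history `h`. -/
noncomputable def postMean (h : History A) (a : A) : ℝ :=
  (∫ w, w a * lik w h ∂P) / ∫ w, lik w h ∂P

/-- Prior assumption (i): each arm can be the (strictly) best arm. -/
def EachArmCanBeBest : Prop := ∀ a : A, 0 < P {w | ∀ a' : A, a' ≠ a → w a' < w a}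

/-- Prior assumption (ii): posterior mean rewards are pairwise distinct
given any feasible history. -/
def DistinctPosteriorMeans : Prop :=
  ∀ h : History A, Feasible P h → ∀ a a' : A, a ≠ a' → postMean P h a ≠ postMean P h a'

/-- `alg` is (a version of) `BayesGreedy`: on every feasible history it only plays arms
with the largest posterior mean reward. -/
def IsBayesGreedy (alg : Alg A) : Prop :=
  ∀ h : History A, Feasible P h →
    ∀ a ∈ (alg h).support, ∀ a' : A, postMean P h a' ≤ postMean P h a

/-- `alg` is (a version of) `StaticGreedy`: it always plays an arm with the largest
prior mean reward. -/
def IsStaticGreedy (alg : Alg A) : Prop :=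
  ∀ h : History A, ∀ a ∈ (alg h).support,
    ∀ a' : A, postMean P ([] : History A) a' ≤ postMean P ([] : History A) a

/-- Marginal probability that a stand-alone run of `alg` produces history `h`. -/
noncomputable def prH (alg : Alg A) (h : History A) : ℝ := ∫ w, hProb alg w h ∂P

/-- `alg` and `alg'` deviate at (local, 1-indexed) step `n`: there is a set `H` of
histories over the previous `n-1` steps, reached with positive probability by both
algorithms, on which they choose different distributions over arms. -/
def DeviatesAt (alg alg' : Alg A) (n : ℕ) : Prop :=
  ∃ H : Set (History A),
    (∀ h ∈ H, h.length + 1 = n) ∧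
    (∃ h ∈ H, 0 < prH P alg h) ∧ (∃ h ∈ H, 0 < prH P alg' h) ∧
    (∀ h ∈ H, alg h ≠ alg' h)

/-- `alg` deviates from `alg'` starting from step `n₀`:
`n₀` is the smallest step at which they deviate. -/
def DeviatesFrom (alg alg' : Alg A) (n₀ : ℕ) : Prop :=
  DeviatesAt P alg alg' n₀ ∧ ∀ n < n₀, ¬ DeviatesAt P alg alg' n

/-- `E[rew(n)]`: the Bayesian-expected reward collected at local step `n` (1-indexed)
by a stand-alone run of `alg`. -/
noncomputable def rewE (alg : Alg A) (n : ℕ) : ℝ :=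
  ∑' h : {h : History A // h.length + 1 = n},
    ∫ w, hProb alg w h.1 * ∑ a : A, ((alg h.1) a).toReal * w a ∂P

/-- `E[max_a μ_a]`: Bayesian-expected reward of the best arm. -/
noncomputable def optE : ℝ := ∫ w, ⨆ a : A, w a ∂P

/-- Bayesian instantaneous regret of `alg` at local step `n` (stand-alone run). -/
noncomputable def BIR (alg : Alg A) (n : ℕ) : ℝ := optE P - rewE P alg n

/-- `alg` is Bayesian-monotone: its Bayesian-expected reward is non-decreasing in `n`. -/
def BayesianMonotone (alg : Alg A) : Prop :=
  ∀ n m : ℕ, 1 ≤ n → n ≤ m → rewE P alg n ≤ rewE P alg m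

/- ### The competition game -/

/-- Bayesian-expected reward of the next local step of `alg`, when the joint
distribution over (mean vector, pair of local histories) has density `g` against `P`,
and `sel` extracts `alg`'s local history from the pair. -/
noncomputable def nextStepReward (alg : Alg A) (sel : History A × History A → History A)
    (g : (A → ℝ) → History A × History A → ℝ) : ℝ :=
  ∑' s : History A × History A, ∫ w, g w s * ∑ a : A, ((alg (sel s)) a).toReal * w a ∂P

/-- One global round of the game: the current agent chooses principal 1 with
probability `q`; the chosen principal's algorithm advances one local step. -/
noncomputable def stepDist (alg1 alg2 : Alg A) (q : ℝ)
    (g : (A → ℝ) → History A × History A → ℝ) :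
    (A → ℝ) → History A × History A → ℝ := fun w s =>
  (match s.1 with
   | [] => 0
   | (a, r) :: h1' =>
       q * g w (h1', s.2) * ((alg1 h1') a).toReal * (if r then w a else 1 - w a)) +
  (match s.2 with
   | [] => 0
   | (a, r) :: h2' =>
       (1 - q) * g w (s.1, h2') * ((alg2 h2') a).toReal * (if r then w a else 1 - w a))

/-- Joint distribution (density against the prior) over the pair of local histories
after `t` global rounds of the competition game, when the principals play
`(alg1, alg2)` and agents respond via `fresp`. -/
noncomputable def gameDist (alg1 alg2 : Alg A) (fresp : ℝ → ℝ) :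
    ℕ → (A → ℝ) → History A × History A → ℝ
  | 0 => fun _ s => if s = (([] : History A), ([] : History A)) then 1 else 0
  | t + 1 =>
      stepDist alg1 alg2
        (fresp (nextStepReward P alg1 Prod.fst (gameDist alg1 alg2 fresp t) -
                nextStepReward P alg2 Prod.snd (gameDist alg1 alg2 fresp t)))
        (gameDist alg1 alg2 fresp t)

/-- `PMR₁(t) = E[r_t | i_t = 1] = E[rew_1(n_1(t)+1)]`: posterior mean reward of
principal 1 at global round `t` (rounds are 1-indexed). -/
noncomputable def PMR1 (alg1 alg2 : Alg A) (fresp : ℝ → ℝ) (t : ℕ) : ℝ :=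
  nextStepReward P alg1 Prod.fst (gameDist P alg1 alg2 fresp (t - 1))

/-- `PMR₂(t)`: posterior mean reward of principal 2 at global round `t`. -/
noncomputable def PMR2 (alg1 alg2 : Alg A) (fresp : ℝ → ℝ) (t : ℕ) : ℝ :=
  nextStepReward P alg2 Prod.snd (gameDist P alg1 alg2 fresp (t - 1))

/-- Probability that agent `t` chooses principal 1:
`Pr[i_t = 1] = fresp (PMR₁(t) - PMR₂(t))`. -/
noncomputable def probChoose1 (alg1 alg2 : Alg A) (fresp : ℝ → ℝ) (t : ℕ) : ℝ :=
  fresp (PMR1 P alg1 alg2 fresp t - PMR2 P alg1 alg2 fresp t)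

/-- Expected number of the `T` agents that choose principal 1 (principal 1's utility). -/
noncomputable def marketShare1 (alg1 alg2 : Alg A) (fresp : ℝ → ℝ) (T : ℕ) : ℝ :=
  ∑ t ∈ Finset.Icc 1 T, probChoose1 P alg1 alg2 fresp t

/-- Expected number of the `T` agents that choose principal 2 (principal 2's utility). -/
noncomputable def marketShare2 (alg1 alg2 : Alg A) (fresp : ℝ → ℝ) (T : ℕ) : ℝ :=
  ∑ t ∈ Finset.Icc 1 T, (1 - probChoose1 P alg1 alg2 fresp t)

/-- `(a1, a2)` is a (pure) Nash equilibrium of the competition game with horizon `T`,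
response function `fresp`, and feasible strategy set `F`; each principal's utility
is the expected number of agents who choose her. -/
def IsNash (F : Set (Alg A)) (fresp : ℝ → ℝ) (T : ℕ) (a1 a2 : Alg A) : Prop :=
  a1 ∈ F ∧ a2 ∈ F ∧
  (∀ a1' ∈ F, marketShare1 P a1' a2 fresp T ≤ marketShare1 P a1 a2 fresp T) ∧
  (∀ a2' ∈ F, marketShare2 P a1 a2' fresp T ≤ marketShare2 P a1 a2 fresp T)

/- ### Response functions -/

/-- `HardMax` response function (its value at `0` — the tie-breaking rule —
is specified separately). -/
def IsHardMax (f : ℝ → ℝ) : Prop :=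
  (∀ x : ℝ, 0 < x → f x = 1) ∧ (∀ x : ℝ, x < 0 → f x = 0)

/-- `HardMax&Random` response function with baseline probability `ε₀ = f(-1)`. -/
def IsHardMaxRandom (f : ℝ → ℝ) (ε₀ : ℝ) : Prop :=
  ε₀ ∈ Set.Ioo (0:ℝ) (1/2 : ℝ) ∧ f (-1) = ε₀ ∧
  (∀ x : ℝ, 0 < x → f x = 1 - ε₀) ∧ (∀ x : ℝ, x < 0 → f x = ε₀)

/-- A symmetric response function: `f(x) + f(-x) = 1` for all `x ∈ [0,1]`. -/
def SymmetricResp (f : ℝ → ℝ) : Prop := ∀ x ∈ Set.Icc (0:ℝ) 1, f x + f (-x) = 1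

/-- `SoftMax` response function with smoothness constants `δ₀, c₀, c₀'`. -/
def IsSoftMax (f : ℝ → ℝ) (δ₀ c₀ c₀' : ℝ) : Prop :=
  (∃ ε ∈ Set.Ioo (0:ℝ) (1/2 : ℝ), ∀ x : ℝ, f x ∈ Set.Icc ε (1 - ε)) ∧
  f 0 = 1/2 ∧ 0 < δ₀ ∧ 0 < c₀ ∧ 0 < c₀' ∧
  ∀ x ∈ Set.Icc (-δ₀) δ₀, DifferentiableAt ℝ f x ∧ c₀ ≤ deriv f x ∧ deriv f x ≤ c₀'

/-- `alg1` BIR-dominates `alg2` starting from step `n₀`: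
`BIR₁(ε₀ n / 2) / BIR₂(n) < 1/2` for all `n ≥ n₀`. -/
def BIRDominates (alg1 alg2 : Alg A) (ε₀ : ℝ) (n₀ : ℕ) : Prop :=
  ∀ n : ℕ, n₀ ≤ n → BIR P alg1 ⌊ε₀ * n / 2⌋₊ / BIR P alg2 n < 1/2

/-- `alg1` weakly BIR-dominates `alg2` with constants `β₀, α₀ ∈ (0,1/2)`, from step `n₀`:
`BIR₁((1-β₀) n) / BIR₂(n) < 1 - α₀` for all `n ≥ n₀`. -/
def WeakBIRDominates (alg1 alg2 : Alg A) (β₀ α₀ : ℝ) (n₀ : ℕ) : Prop :=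
  ∀ n : ℕ, n₀ ≤ n → BIR P alg1 ⌊(1 - β₀) * n⌋₊ / BIR P alg2 n < 1 - α₀

end BayesianChoice

namespace BayesianChoice

open MeasureTheory

noncomputable def qPr {A : Type} (alg : Alg A) : History A → ℝ
  | [] => 1
  | (a, _) :: h => qPr alg h * ((alg h) a).toReal

lemma hProb_eq_qPr {A : Type} (alg : Alg A) (w : A → ℝ) (h : History A) :
    hProb alg w h = qPr alg h * lik w h := by
  induction h with
  | nil => simp [hProb, qPr, lik]
  | cons x h ih =>
    obtain ⟨a, r⟩ := x
    simp only [hProb, qPr, lik, ih]; ring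

lemma qPr_nonneg {A : Type} (alg : Alg A) (h : History A) : 0 ≤ qPr alg h := by
  induction h with
  | nil => simp [qPr]
  | cons x h ih =>
    obtain ⟨a, r⟩ := x
    exact mul_nonneg ih ENNReal.toReal_nonneg

lemma lik_mem {A : Type} (w : A → ℝ) (hw : ∀ a, w a ∈ Set.Icc (0:ℝ) 1) (h : History A) :
    lik w h ∈ Set.Icc (0:ℝ) 1 := by
  induction h with
  | nil => simp [lik]
  | cons x h ih =>
    obtain ⟨a, r⟩ := x
    have h1 : (if r = true then w a else 1 - w a) ∈ Set.Icc (0:ℝ) 1 := by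
      have := hw a
      split_ifs
      · exact this
      · exact ⟨by linarith [this.2], by linarith [this.1]⟩
    exact ⟨mul_nonneg ih.1 h1.1, mul_le_one₀ ih.2 h1.1 h1.2⟩

lemma lik_cons_le {A : Type} (w : A → ℝ) (hw : ∀ a, w a ∈ Set.Icc (0:ℝ) 1) (h : History A)
    (x : A × Bool) : lik w (x :: h) ≤ lik w h := by
  obtain ⟨a, r⟩ := x
  have h0 := lik_mem w hw h
  have h1 : (if r = true then w a else 1 - w a) ≤ 1 := by
    have := hw a
    split_ifs
    · exact this.2
    · linarith [this.1]
  exact mul_le_of_le_one_right h0.1 h1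

lemma lik_measurable {A : Type} (h : History A) : Measurable (fun w : A → ℝ => lik w h) := by
  induction h with
  | nil => simp [lik]
  | cons x h ih =>
    obtain ⟨a, r⟩ := x
    simp only [lik]
    apply ih.mul
    cases r
    · simpa using (measurable_pi_apply a).const_sub 1
    · simpa using measurable_pi_apply a

section
variable {A : Type} [Fintype A] (P : Measure (A → ℝ)) [IsProbabilityMeasure P]

lemma cube_ae (hcube : PriorOnUnitCube P) : ∀ᵐ w ∂P, ∀ a : A, w a ∈ Set.Icc (0:ℝ) 1 := by
  have hm : MeasurableSet {w : A → ℝ | ∀ a : A, w a ∈ Set.Icc (0:ℝ) 1} := by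
    have : {w : A → ℝ | ∀ a : A, w a ∈ Set.Icc (0:ℝ) 1}
        = ⋂ a, (fun w : A → ℝ => w a) ⁻¹' Set.Icc 0 1 := by
      ext w; simp
    rw [this]
    exact MeasurableSet.iInter fun a => measurable_pi_apply a measurableSet_Icc
  exact (mem_ae_iff_prob_eq_one hm).2 hcube

lemma lik_integrable (hcube : PriorOnUnitCube P) (h : History A) :
    Integrable (fun w => lik w h) P := by
  refine Integrable.of_bound (lik_measurable h).aestronglyMeasurable 1 ?_
  filter_upwards [cube_ae P hcube] with w hw
  have := lik_mem w hw h
  rw [Real.norm_of_nonneg this.1]; exact this.2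

lemma mul_lik_integrable (hcube : PriorOnUnitCube P) (h : History A) (a : A) :
    Integrable (fun w => w a * lik w h) P := by
  refine Integrable.of_bound
    ((measurable_pi_apply a).mul (lik_measurable h)).aestronglyMeasurable 1 ?_
  filter_upwards [cube_ae P hcube] with w hw
  have h1 := lik_mem w hw h
  rw [Real.norm_of_nonneg (mul_nonneg (hw a).1 h1.1)]
  exact mul_le_one₀ (hw a).2 h1.1 h1.2

lemma lik_int_nonneg (hcube : PriorOnUnitCube P) (h : History A) : 0 ≤ ∫ w, lik w h ∂P := by
  apply integral_nonneg_of_ae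
  filter_upwards [cube_ae P hcube] with w hw
  exact (lik_mem w hw h).1

lemma feasible_tail (hcube : PriorOnUnitCube P) (h : History A) (x : A × Bool)
    (hf : Feasible P (x :: h)) : Feasible P h := by
  refine lt_of_lt_of_le hf (integral_mono_ae (lik_integrable P hcube _) (lik_integrable P hcube _) ?_)
  filter_upwards [cube_ae P hcube] with w hw
  exact lik_cons_le w hw h x

lemma mul_lik_int_zero (hcube : PriorOnUnitCube P) (h : History A) (a : A)
    (hf : ¬ Feasible P h) : ∫ w, w a * lik w h ∂P = 0 := by
  apply le_antisymm
  · refine le_trans (integral_mono_ae (mul_lik_integrable P hcube _ _)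
      (lik_integrable P hcube h) ?_) (not_lt.1 hf)
    filter_upwards [cube_ae P hcube] with w hw
    exact mul_le_of_le_one_left (lik_mem w hw h).1 (hw a).2
  · apply integral_nonneg_of_ae
    filter_upwards [cube_ae P hcube] with w hw
    exact mul_nonneg (hw a).1 (lik_mem w hw h).1

lemma prH_eq (alg : Alg A) (h : History A) : prH P alg h = qPr alg h * ∫ w, lik w h ∂P := by
  simp only [prH, hProb_eq_qPr]
  rw [integral_const_mul]

lemma prH_pos (hcube : PriorOnUnitCube P) (alg : Alg A) (h : History A) :
    0 < prH P alg h ↔ 0 < qPr alg h ∧ Feasible P h := by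
  rw [prH_eq]
  constructor
  · intro hp
    exact ⟨pos_of_mul_pos_left hp (lik_int_nonneg P hcube h),
      pos_of_mul_pos_right hp (qPr_nonneg alg h)⟩
  · rintro ⟨h1, h2⟩
    exact mul_pos h1 h2

lemma term_eq (hcube : PriorOnUnitCube P) (alg : Alg A) (h : History A) :
    ∫ w, hProb alg w h * ∑ a : A, ((alg h) a).toReal * w a ∂P
      = qPr alg h * ∑ a : A, ((alg h) a).toReal * ∫ w, w a * lik w h ∂P := by
  have : ∀ w : A → ℝ, hProb alg w h * ∑ a : A, ((alg h) a).toReal * w a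
      = qPr alg h * ∑ a : A, ((alg h) a).toReal * (w a * lik w h) := by
    intro w
    rw [hProb_eq_qPr, mul_assoc, Finset.mul_sum]
    congr 1
    exact Finset.sum_congr rfl fun a _ => by ring
  simp only [this]
  rw [integral_const_mul, integral_finset_sum]
  · simp only [integral_const_mul]
  · intro a _
    exact (mul_lik_integrable P hcube h a).const_mul _

lemma q_eq (hcube : PriorOnUnitCube P) (alg1 alg2 : Alg A) (n₀ : ℕ)
    (hno : ∀ n < n₀, ¬ DeviatesAt P alg2 alg1 n) (h : History A) (hl : h.length + 1 ≤ n₀)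
    (hf : Feasible P h) : qPr alg2 h = qPr alg1 h := by
  induction h with
  | nil => rfl
  | cons x h ih =>
    have hf' := feasible_tail P hcube h x hf
    rw [List.length_cons] at hl
    have e := ih (by omega) hf'
    obtain ⟨a, r⟩ := x
    simp only [qPr, e]
    by_cases h0 : qPr alg1 h = 0
    · simp [h0]
    have hp : 0 < qPr alg1 h := lt_of_le_of_ne (qPr_nonneg _ _) (Ne.symm h0)
    have : alg2 h = alg1 h := by
      by_contra hne
      refine hno (h.length + 1) (by omega) ⟨{h}, ?_, ⟨h, rfl, ?_⟩, ⟨h, rfl, ?_⟩, ?_⟩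
      · rintro _ rfl; rfl
      · exact (prH_pos P hcube _ _).2 ⟨e ▸ hp, hf'⟩
      · exact (prH_pos P hcube _ _).2 ⟨hp, hf'⟩
      · rintro _ rfl; exact hne
    rw [this]

lemma pmf_sum (p : PMF A) : ∑ a, (p a).toReal = 1 := by
  rw [← ENNReal.toReal_sum fun a _ => p.apply_ne_top a, ← tsum_fintype (L := .unconditional A), p.tsum_coe]
  rfl

lemma greedy_spec (hdistinct : DistinctPosteriorMeans P) (alg1 : Alg A)
    (hBG : IsBayesGreedy P alg1) (h : History A) (hf : Feasible P h) :
    ∃ b, alg1 h = PMF.pure b ∧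
      ∀ a, a ≠ b → ∫ w, w a * lik w h ∂P < ∫ w, w b * lik w h ∂P := by
  obtain ⟨b, hb⟩ := (alg1 h).support_nonempty
  have key : ∀ a, a ≠ b → postMean P h a < postMean P h b := fun a ha =>
    lt_of_le_of_ne (hBG h hf b hb a) (hdistinct h hf a b ha)
  refine ⟨b, ?_, fun a ha => (div_lt_div_iff_of_pos_right hf).1 (key a ha)⟩
  have hz : ∀ a, a ≠ b → alg1 h a = 0 := by
    intro a ha
    by_contra h0
    exact absurd (hBG h hf a ((PMF.mem_support_iff _ _).2 h0) b) (not_le.2 (key a ha))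
  have h1 : alg1 h b = 1 := by
    rw [← (alg1 h).tsum_coe, tsum_eq_single b hz]
  ext a
  by_cases ha : a = b
  · subst ha; simp [h1]
  · simp [hz a ha, ha]

lemma pure_sum (b : A) (M : A → ℝ) : ∑ a, ((PMF.pure b) a).toReal * M a = M b := by
  rw [Finset.sum_eq_single b]
  · simp
  · intro a _ ha; simp [ha]
  · simp

lemma sum_le_of_max (p : PMF A) (b : A) (M : A → ℝ) (hM : ∀ a, a ≠ b → M a < M b) :
    ∑ a, (p a).toReal * M a ≤ M b := by
  calc ∑ a, (p a).toReal * M a ≤ ∑ a, (p a).toReal * M b := by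
        refine Finset.sum_le_sum fun a _ => mul_le_mul_of_nonneg_left ?_ ENNReal.toReal_nonneg
        by_cases ha : a = b
        · rw [ha]
        · exact (hM a ha).le
    _ = M b := by rw [← Finset.sum_mul, pmf_sum, one_mul]

lemma sum_lt_of_max (p : PMF A) (b : A) (M : A → ℝ) (hM : ∀ a, a ≠ b → M a < M b)
    (hp : p ≠ PMF.pure b) : ∑ a, (p a).toReal * M a < M b := by
  have hex : ∃ a, a ≠ b ∧ p a ≠ 0 := by
    by_contra! hz
    apply hp
    have h1 : p b = 1 := by
      rw [← p.tsum_coe, tsum_eq_single b hz]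
    ext a
    by_cases ha : a = b
    · subst ha; simp [h1]
    · simp [hz a ha, ha]
  obtain ⟨c, hc, hpc⟩ := hex
  calc ∑ a, (p a).toReal * M a < ∑ a, (p a).toReal * M b := by
        refine Finset.sum_lt_sum (fun a _ => mul_le_mul_of_nonneg_left ?_ ENNReal.toReal_nonneg)
          ⟨c, Finset.mem_univ _, mul_lt_mul_of_pos_left (hM c hc)
            (ENNReal.toReal_pos hpc (p.apply_ne_top c))⟩
        by_cases ha : a = b
        · rw [ha]
        · exact (hM a ha).le
    _ = M b := by rw [← Finset.sum_mul, pmf_sum, one_mul]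

end

/-- **Lemma (deviating from BayesGreedy loses reward).**
If `alg1` is `BayesGreedy` and `alg2` deviates from `BayesGreedy` starting from some
local step `n₀ < T`, then the Bayesian-expected rewards of the two algorithms, run in
isolation, satisfy `E[rew₁(n₀)] > E[rew₂(n₀)]`.  (This holds for any response
function, since it only concerns the stand-alone performance of each algorithm.) -/
theorem bayesGreedy_deviation_strictly_smaller_reward
    {A : Type} [Fintype A] [Nonempty A]
    (P : Measure (A → ℝ)) [IsProbabilityMeasure P]
    (hcube : PriorOnUnitCube P)
    (hbest : EachArmCanBeBest P)
    (hdistinct : DistinctPosteriorMeans P)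
    (alg1 alg2 : Alg A) (hBG : IsBayesGreedy P alg1)
    (T n₀ : ℕ) (hn₀T : n₀ < T)
    (hdev : DeviatesFrom P alg2 alg1 n₀) :
    rewE P alg2 n₀ < rewE P alg1 n₀ := by
  obtain ⟨⟨H, hlen, ⟨h₀, hh₀, hp₀⟩, -, hne⟩, hno⟩ := hdev
  have hfin : Finite {h : History A // h.length + 1 = n₀} := by
    have h1 : {h : History A | h.length + 1 = n₀} ⊆ {h : History A | h.length = n₀ - 1} := by
      intro h hh
      simp only [Set.mem_setOf_eq] at hh ⊢
      omega
    exact ((List.finite_length_eq (A × Bool) (n₀ - 1)).subset h1).to_subtype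
  have := Fintype.ofFinite {h : History A // h.length + 1 = n₀}
  unfold rewE
  simp only [term_eq P hcube]
  rw [tsum_fintype, tsum_fintype]
  refine Finset.sum_lt_sum ?_ ⟨⟨h₀, hlen h₀ hh₀⟩, Finset.mem_univ _, ?_⟩
  · rintro ⟨h, hl⟩ -
    by_cases hf : Feasible P h
    · obtain ⟨b, hb, hM⟩ := greedy_spec P hdistinct alg1 hBG h hf
      rw [q_eq P hcube alg1 alg2 n₀ hno h hl.le hf]
      refine mul_le_mul_of_nonneg_left ?_ (qPr_nonneg _ _)
      simp only [hb]
      rw [pure_sum b fun a => ∫ w, w a * lik w h ∂P]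
      exact sum_le_of_max (alg2 h) b (fun a => ∫ w, w a * lik w h ∂P) hM
    · simp [mul_lik_int_zero P hcube h _ hf]
  · obtain ⟨hq, hf⟩ := (prH_pos P hcube _ _).1 hp₀
    obtain ⟨b, hb, hM⟩ := greedy_spec P hdistinct alg1 hBG h₀ hf
    have e := q_eq P hcube alg1 alg2 n₀ hno h₀ (hlen h₀ hh₀).le hf
    have hn := hne h₀ hh₀
    rw [hb] at hn
    simp only [← e]
    refine mul_lt_mul_of_pos_left ?_ hq
    simp only [hb]
    rw [pure_sum b fun a => ∫ w, w a * lik w h₀ ∂P]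
    exact sum_lt_of_max (alg2 h₀) b (fun a => ∫ w, w a * lik w h₀ ∂P) hM hn

end BayesianChoice
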